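/- arXiv:2010.14496 — 6 statements merged into one kernel-verified Lean document; each statement's English description precedes it below -/
import Mathlib

section
/- For real numbers γ, γ̃ with 0 ≤ γ < γ̃ < 1 and every integer t ≥ 1, the following identity holds: ∑_{n=1}^{t} [(1−γ̃)(γ̃−γ)^{n−1}/(1−γ)^n] · C(t−1, t−n) · γ^{t−n} · (1−γ)^n = (1−γ̃) · γ̃^{t−1}. That is, the per-step mixture weights α_n = (1−γ̃)(γ̃−γ)^{n−1}/(1−γ)^n reweight the negative binomial timestep distributions p_n(t) = C(t−1, t−n) γ^{t−n} (1−γ)^n into the geometric distribution with parameter 1−γ̃. -/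
/-- The per-step mixture weights `α n = (1−γ̃)(γ̃−γ)^(n−1)/(1−γ)^n` reweight the
negative binomial timestep pmfs `p_n(t) = C(t−1, t−n) γ^(t−n) (1−γ)^n` into the
geometric distribution with parameter `1 − γ̃`. -/
theorem gamma_rollout_reweight_pointwise (γ γt : ℝ) (h0 : 0 ≤ γ) (h1 : γ < γt) (h2 : γt < 1)
    (t : ℕ) (ht : 1 ≤ t) :
    ∑ n ∈ Finset.Icc 1 t,
      ((1 - γt) * (γt - γ) ^ (n - 1) / (1 - γ) ^ n) *
        (((t - 1).choose (t - n) : ℝ) * γ ^ (t - n) * (1 - γ) ^ n)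
      = (1 - γt) * γt ^ (t - 1) := by
  obtain ⟨m, rfl⟩ : ∃ m, t = m + 1 := ⟨t - 1, by omega⟩
  have hγ : (1 - γ) ≠ 0 := by linarith
  have hbinom : γt ^ m = ∑ k ∈ Finset.range (m + 1),
      (γt - γ) ^ k * γ ^ (m - k) * (m.choose k : ℝ) := by
    rw [← add_pow, sub_add_cancel]
  rw [← Finset.Ico_add_one_right_eq_Icc, Finset.sum_Ico_eq_sum_range]
  simp only [Nat.add_sub_cancel]
  rw [hbinom, Finset.mul_sum]
  refine Finset.sum_congr rfl fun k hk => ?_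
  have hkm : k ≤ m := Nat.lt_succ_iff.mp (Finset.mem_range.mp hk)
  rw [show m + 1 - (1 + k) = m - k by omega, Nat.add_sub_cancel_left, Nat.choose_symm hkm]
  field_simp
end

section
/- Let S be a nonempty finite type, let P be a row-stochastic S×S real matrix, let γ ∈ (0,1), and let μ_γ = (1−γ) ∑_{t=1}^{∞} γ^{t−1} P^t. Then for every n ≥ 1, the n-th matrix power of μ_γ is the negative-binomial mixture of powers of P: μ_γ^n = ∑_{t=n}^{∞} C(t−1, t−n) γ^{t−n} (1−γ)^n P^t. That is, the n-th sequential step of a γ-model rollout samples states at timesteps distributed as NB(n, 1−γ). -/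
/-- The normalized discounted occupancy matrix `μ_γ = (1−γ) ∑_{t≥1} γ^(t−1) P^t`. -/
noncomputable def occupancy {S : Type*} [Fintype S] [DecidableEq S]
    (γ : ℝ) (P : Matrix S S ℝ) : Matrix S S ℝ :=
  (1 - γ) • ∑' t : ℕ, γ ^ t • P ^ (t + 1)

/-- In a real normed algebra, if `γ • x` has norm less than one, then the powers of
`∑_{t≥0} γ^t x^(t+1)` are given by the negative binomial series. -/
theorem hasSum_negBinomial_smul_pow {A : Type*} [NormedRing A] [NormedAlgebra ℝ A]
    [CompleteSpace A] {γ : ℝ} {x : A} (hx : ‖γ • x‖ < 1) (k : ℕ) :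
    HasSum (fun t : ℕ ↦ (((t + k).choose t : ℝ) * γ ^ t) • x ^ (t + (k + 1)))
      ((∑' t : ℕ, γ ^ t • x ^ (t + 1)) ^ (k + 1)) := by
  have hgeom : HasSum (fun t : ℕ ↦ γ ^ t • x ^ (t + 1)) ((Ring.inverse (1 - γ • x)) * x) := by
    simpa [smul_pow, pow_succ] using (hasSum_geom_series_inverse (γ • x) hx).mul_right x
  have hcomm : Commute (Ring.inverse (1 - γ • x)) x :=
    hgeom.unique <| by
      simpa [smul_pow, pow_succ'] using (hasSum_geom_series_inverse (γ • x) hx).mul_left x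
  rw [hgeom.tsum_eq, hcomm.mul_pow]
  refine ((hasSum_choose_mul_geometric_of_norm_lt_one' k hx).mul_right (x ^ (k + 1))).congr_fun ?_
  intro t
  rw [smul_pow, Nat.choose_symm_add, pow_add x t, mul_smul, ← smul_mul_assoc, ← smul_mul_assoc,
    Nat.cast_smul_eq_nsmul, nsmul_eq_mul]

open scoped Matrix.Norms.Operator in
/-- A row-stochastic matrix has `ℓ^∞` operator norm at most one. -/
theorem Matrix.linfty_opNorm_le_one_of_rowStochastic {S : Type*} [Fintype S]
    {P : Matrix S S ℝ} (hP0 : ∀ i j, 0 ≤ P i j) (hP1 : ∀ i, ∑ j, P i j = 1) : ‖P‖ ≤ 1 := by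
  rw [Matrix.linfty_opNorm_def, ← NNReal.coe_one, NNReal.coe_le_coe]
  refine Finset.sup_le fun i _ ↦ ?_
  rw [← NNReal.coe_le_coe]
  simp [abs_of_nonneg (hP0 i _), hP1 i]

open scoped Matrix.Norms.Operator in
/-- The `n`-th matrix power of the normalized discounted occupancy `μ_γ` is the
negative-binomial mixture of powers of `P`:
`μ_γ^n = ∑_{t≥n} C(t−1, t−n) γ^(t−n) (1−γ)^n P^t`. -/
theorem occupancy_pow_eq_negBinomial_mixture {S : Type*} [Fintype S] [DecidableEq S] [Nonempty S]
    (P : Matrix S S ℝ) (hP0 : ∀ i j, 0 ≤ P i j) (hP1 : ∀ i, ∑ j, P i j = 1)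
    (γ : ℝ) (hγ0 : 0 < γ) (hγ1 : γ < 1) (n : ℕ) (hn : 1 ≤ n) :
    occupancy γ P ^ n =
      ∑' t : ℕ,
        (if n ≤ t then ((t - 1).choose (t - n) : ℝ) * γ ^ (t - n) * (1 - γ) ^ n else 0) • P ^ t := by
  obtain ⟨k, rfl⟩ := Nat.exists_eq_add_of_le' hn
  have hnorm : ‖γ • P‖ < 1 := by
    rw [norm_smul, Real.norm_of_nonneg hγ0.le]
    exact (mul_le_of_le_one_right hγ0.le
      (Matrix.linfty_opNorm_le_one_of_rowStochastic hP0 hP1)).trans_lt hγ1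
  have hsum := (hasSum_negBinomial_smul_pow hnorm k).const_smul ((1 - γ) ^ (k + 1))
  rw [← smul_pow] at hsum
  refine HasSum.tsum_eq ?_ |>.symm
  refine ((add_left_injective (k + 1)).hasSum_iff ?_).mp ?_
  · intro t ht
    rw [if_neg, zero_smul]
    exact fun h ↦ ht ⟨t - (k + 1), Nat.sub_add_cancel h⟩
  · refine HasSum.congr_fun hsum fun t ↦ ?_
    simp [smul_smul, mul_comm, ← add_assoc]
end

section
/- (Theorem 1, tabular form.) Let S be a nonempty finite type, let P be a row-stochastic S×S real matrix, and let 0 < γ < γ̃ < 1. Define μ_γ = (1−γ) ∑_{t=1}^{∞} γ^{t−1} P^t and likewise μ_{γ̃} = (1−γ̃) ∑_{t=1}^{∞} γ̃^{t−1} P^t. Then the occupancy at the larger discount is the weighted sum of the powers of the occupancy at the smaller discount: μ_{γ̃} = ∑_{n=1}^{∞} α_n μ_γ^n, where α_n = (1−γ̃)(γ̃−γ)^{n−1}/(1−γ)^n (the series converging entrywise). -/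
/-- The mixture weights `α n = (1−γ̃)(γ̃−γ)^(n−1)/(1−γ)^n`. -/
noncomputable def alpha (γ γt : ℝ) (n : ℕ) : ℝ :=
  (1 - γt) * (γt - γ) ^ (n - 1) / (1 - γ) ^ n

section NormedAlgebra

variable {A : Type*} [NormedRing A] [NormedAlgebra ℝ A]

lemma norm_smul_lt_one {a : A} (ha : ‖a‖ ≤ 1) {c : ℝ} (hc0 : 0 ≤ c) (hc1 : c < 1) :
    ‖c • a‖ < 1 := by
  rw [norm_smul, Real.norm_of_nonneg hc0]
  exact (mul_le_of_le_one_right hc0 ha).trans_lt hc1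

lemma norm_smul_pow_succ_le {a : A} (ha : ‖a‖ ≤ 1) {c : ℝ} (hc0 : 0 ≤ c) (t : ℕ) :
    ‖c ^ t • a ^ (t + 1)‖ ≤ c ^ t := by
  rw [norm_smul, Real.norm_of_nonneg (pow_nonneg hc0 t)]
  exact mul_le_of_le_one_right (pow_nonneg hc0 t)
    ((norm_pow_le' a t.succ_pos).trans (pow_le_one₀ (norm_nonneg a) ha))

lemma norm_discounted_sum_le_one {a : A} (ha : ‖a‖ ≤ 1) {c : ℝ} (hc0 : 0 ≤ c) (hc1 : c < 1) :
    ‖(1 - c) • ∑' t : ℕ, c ^ t • a ^ (t + 1)‖ ≤ 1 := by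
  have hc : 0 < 1 - c := sub_pos.2 hc1
  rw [norm_smul, Real.norm_of_nonneg hc.le]
  calc (1 - c) * ‖∑' t : ℕ, c ^ t • a ^ (t + 1)‖
      ≤ (1 - c) * (1 - c)⁻¹ := by
        gcongr
        exact tsum_of_norm_bounded (hasSum_geometric_of_lt_one hc0 hc1)
          (norm_smul_pow_succ_le ha hc0)
    _ = 1 := mul_inv_cancel₀ hc.ne'

variable [CompleteSpace A]

lemma tsum_smul_pow_succ {a : A} (ha : ‖a‖ ≤ 1) {c : ℝ} (hc0 : 0 ≤ c) (hc1 : c < 1) :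
    ∑' t : ℕ, c ^ t • a ^ (t + 1) = a * ∑' t : ℕ, (c • a) ^ t := by
  rw [← (summable_geometric_of_norm_lt_one (norm_smul_lt_one ha hc0 hc1)).tsum_mul_left]
  simp only [smul_pow, mul_smul_comm, pow_succ']

/-- The resolvent identity behind the change of discount. -/
lemma discounted_sum_reweighting {a : A} (ha : ‖a‖ ≤ 1) {c d : ℝ}
    (hc0 : 0 ≤ c) (hcd : c ≤ d) (hd1 : d < 1) :
    (1 - d) • ∑' t : ℕ, d ^ t • a ^ (t + 1) =
      ∑' n : ℕ, ((1 - d) * (d - c) ^ n / (1 - c) ^ (n + 1)) •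
        ((1 - c) • ∑' t : ℕ, c ^ t • a ^ (t + 1)) ^ (n + 1) := by
  have hc1 : c < 1 := hcd.trans_lt hd1
  have hc : 0 < 1 - c := sub_pos.2 hc1
  set m : A := (1 - c) • ∑' t : ℕ, c ^ t • a ^ (t + 1) with hm
  have hm1 : ‖m‖ ≤ 1 := norm_discounted_sum_le_one ha hc0 hc1
  set r : ℝ := (d - c) / (1 - c) with hr
  have hr0 : 0 ≤ r := div_nonneg (sub_nonneg.2 hcd) hc.le
  have hr1 : r < 1 := (div_lt_one hc).2 (by linarith)
  have hterm : ∀ n : ℕ, ((1 - d) * (d - c) ^ n / (1 - c) ^ (n + 1)) • m ^ (n + 1) =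
      ((1 - d) / (1 - c)) • (r ^ n • m ^ (n + 1)) := fun n => by
    rw [smul_smul, hr, div_pow, div_mul_div_comm, pow_succ' (1 - c)]
  have hsum : Summable fun n : ℕ => r ^ n • m ^ (n + 1) :=
    .of_norm_bounded (summable_geometric_of_lt_one hr0 hr1) (norm_smul_pow_succ_le hm1 hr0)
  simp only [hterm]
  rw [hsum.tsum_const_smul, tsum_smul_pow_succ hm1 hr0 hr1,
    tsum_smul_pow_succ ha (hc0.trans hcd) hd1]
  rw [tsum_smul_pow_succ ha hc0 hc1] at hm
  have hR := mul_neg_geom_series (c • a) (norm_smul_lt_one ha hc0 hc1)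
  have hT := geom_series_mul_neg (d • a) (norm_smul_lt_one ha (hc0.trans hcd) hd1)
  have hQ := mul_neg_geom_series (r • m) (norm_smul_lt_one hm1 hr0 hr1)
  set R : A := ∑' t : ℕ, (c • a) ^ t
  set T : A := ∑' t : ℕ, (d • a) ^ t
  set Q : A := ∑' n : ℕ, (r • m) ^ n
  have hrm : 1 - r • m = (1 - d • a) * R := by
    rw [hm, smul_smul, hr, div_mul_cancel₀ _ hc.ne', sub_mul, sub_smul, one_mul, smul_mul_assoc]
    rw [sub_mul, one_mul, smul_mul_assoc] at hR
    rw [← hR]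
    abel
  have hTRQ : T = R * Q := by
    rw [hrm, mul_assoc] at hQ
    exact left_inv_eq_right_inv hT hQ
  rw [hTRQ, hm, smul_mul_assoc, smul_smul, div_mul_cancel₀ _ hc.ne', mul_assoc]

end NormedAlgebra

section Stochastic

attribute [local instance] Matrix.linftyOpNormedRing Matrix.linftyOpNormedAlgebra

lemma linfty_opNorm_le_one_of_stochastic {S : Type*} [Fintype S] [DecidableEq S]
    {P : Matrix S S ℝ} (hP0 : ∀ i j, 0 ≤ P i j) (hP1 : ∀ i, ∑ j, P i j = 1) : ‖P‖ ≤ 1 := by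
  rw [Matrix.linfty_opNorm_def, ← NNReal.coe_one, NNReal.coe_le_coe]
  refine Finset.sup_le fun i _ => ?_
  rw [← NNReal.coe_le_coe]
  simp [Real.norm_of_nonneg (hP0 i _), hP1]

lemma occupancy_reweighting_of_stochastic {S : Type*} [Fintype S] [DecidableEq S]
    {P : Matrix S S ℝ} (hP0 : ∀ i j, 0 ≤ P i j) (hP1 : ∀ i, ∑ j, P i j = 1)
    {γ γt : ℝ} (h0 : 0 ≤ γ) (h1 : γ ≤ γt) (h2 : γt < 1) :
    occupancy γt P = ∑' n : ℕ, alpha γ γt (n + 1) • occupancy γ P ^ (n + 1) :=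
  discounted_sum_reweighting (linfty_opNorm_le_one_of_stochastic hP0 hP1) h0 h1 h2

end Stochastic

/-- Theorem 1, tabular form: the occupancy at the larger discount `γ̃` is the `α`-weighted
sum of the powers of the occupancy at the smaller discount `γ`:
`μ_γ̃ = ∑_{n≥1} α_n μ_γ^n`. -/
theorem occupancy_reweighting {S : Type*} [Fintype S] [DecidableEq S] [Nonempty S]
    (P : Matrix S S ℝ) (hP0 : ∀ i j, 0 ≤ P i j) (hP1 : ∀ i, ∑ j, P i j = 1)
    (γ γt : ℝ) (h0 : 0 < γ) (h1 : γ < γt) (h2 : γt < 1) :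
    occupancy γt P = ∑' n : ℕ, alpha γ γt (n + 1) • occupancy γ P ^ (n + 1) := by
  exact occupancy_reweighting_of_stochastic hP0 hP1 h0.le h1.le h2
end

section
/- (Theorem 2, γ-model-based value expansion, tabular form.) Let S be a nonempty finite type, let P be a row-stochastic S×S real matrix, let 0 < γ < γ̃ < 1, and let r : S → ℝ be a reward vector. Define μ_γ = (1−γ) ∑_{t=1}^{∞} γ^{t−1} P^t and the value vector V = ∑_{t=1}^{∞} γ̃^{t−1} P^t r. Then for every H ≥ 1, V decomposes as a weighted average of H γ-model steps and a terminal value: V = (1/(1−γ̃)) ∑_{n=1}^{H} α_n (μ_γ^n r) + ((γ̃−γ)/(1−γ))^H (μ_γ^H V), where α_n = (1−γ̃)(γ̃−γ)^{n−1}/(1−γ)^n. -/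
/-- The value vector `V = ∑_{t≥1} γ̃^(t−1) P^t r`. -/
noncomputable def valueVec {S : Type*} [Fintype S] [DecidableEq S]
    (γt : ℝ) (P : Matrix S S ℝ) (r : S → ℝ) : S → ℝ :=
  ∑' t : ℕ, γt ^ t • (P ^ (t + 1)).mulVec r

/-- The unnormalized discounted occupancy series of a row-stochastic matrix converges. -/
theorem summable_discounted_pow {S : Type*} [Fintype S] [DecidableEq S] {P : Matrix S S ℝ}
    (hP : P ∈ Matrix.rowStochastic ℝ S) {a : ℝ} (ha0 : 0 ≤ a) (ha1 : a < 1) :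
    Summable fun t : ℕ => a ^ t • P ^ (t + 1) := by
  refine Pi.summable.2 fun i => Pi.summable.2 fun j => ?_
  have hpow (t : ℕ) : P ^ (t + 1) ∈ Matrix.rowStochastic ℝ S := pow_mem hP _
  refine Summable.of_nonneg_of_le (fun t => ?_) (fun t => ?_)
    (summable_geometric_of_lt_one ha0 ha1)
  · exact mul_nonneg (pow_nonneg ha0 t) (Matrix.nonneg_of_mem_rowStochastic (hpow t))
  · exact mul_le_of_le_one_right (pow_nonneg ha0 t) (Matrix.le_one_of_mem_rowStochastic (hpow t))

/-- Peeling off the first term of `∑ a ^ t • x ^ (t + 1)`, with the remaining factor on the left. -/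
theorem tsum_smul_pow_succ_eq_add_mul {R : Type*} [Ring R] [Algebra ℝ R] [TopologicalSpace R]
    [IsTopologicalRing R] [ContinuousConstSMul ℝ R] [T2Space R] {x : R} {a : ℝ}
    (h : Summable fun t : ℕ => a ^ t • x ^ (t + 1)) :
    ∑' t : ℕ, a ^ t • x ^ (t + 1) = x + a • (x * ∑' t : ℕ, a ^ t • x ^ (t + 1)) := by
  rw [← h.tsum_mul_left, ← (h.mul_left x).tsum_const_smul, h.tsum_eq_zero_add]
  simp only [pow_zero, one_smul, zero_add, pow_one, mul_smul_comm, smul_smul, ← pow_succ']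

/-- The resolvent identity for the series `∑ a ^ t • x ^ (t + 1)`. -/
theorem tsum_smul_pow_succ_resolvent {R : Type*} [Ring R] [Algebra ℝ R] [TopologicalSpace R]
    [IsTopologicalRing R] [ContinuousConstSMul ℝ R] [T2Space R] {x : R} {a b : ℝ}
    (ha : Summable fun t : ℕ => a ^ t • x ^ (t + 1))
    (hb : Summable fun t : ℕ => b ^ t • x ^ (t + 1)) :
    ∑' t : ℕ, b ^ t • x ^ (t + 1) = ∑' t : ℕ, a ^ t • x ^ (t + 1) +
      (b - a) • ((∑' t : ℕ, a ^ t • x ^ (t + 1)) * ∑' t : ℕ, b ^ t • x ^ (t + 1)) := by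
  have hcomm : Commute x (∑' t : ℕ, a ^ t • x ^ (t + 1)) :=
    Commute.tsum_right x fun t => ((Commute.refl x).pow_right _).smul_right _
  have hA := tsum_smul_pow_succ_eq_add_mul ha
  have hB := tsum_smul_pow_succ_eq_add_mul hb
  rw [hcomm.eq] at hA
  generalize ∑' t : ℕ, a ^ t • x ^ (t + 1) = A at *
  generalize ∑' t : ℕ, b ^ t • x ^ (t + 1) = B at *
  have hxB : b • (x * B) = B - x := eq_sub_of_add_eq' hB.symm
  have hAx : a • (A * x) = A - x := eq_sub_of_add_eq' hA.symm
  have key : b • (A * B) = B - x + a • (A * B) - (A - x) := by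
    calc b • (A * B) = b • ((x + a • (A * x)) * B) := by rw [← hA]
      _ = b • (x * B) + a • (A * (b • (x * B))) := by
        simp only [add_mul, smul_add, smul_mul_assoc, mul_smul_comm, mul_assoc, smul_comm a b]
      _ = B - x + a • (A * B) - (A - x) := by
        rw [hxB, mul_sub, smul_sub, hAx]; abel
  rw [sub_smul, key]
  abel

/-- The value vector is the discounted occupancy series applied to the reward. -/
theorem valueVec_eq_mulVec {S : Type*} [Fintype S] [DecidableEq S] {P : Matrix S S ℝ} {a : ℝ}
    (h : Summable fun t : ℕ => a ^ t • P ^ (t + 1)) (r : S → ℝ) :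
    valueVec a P r = (∑' t : ℕ, a ^ t • P ^ (t + 1)).mulVec r := by
  have hcont : Continuous fun M : Matrix S S ℝ => M.mulVec r :=
    continuous_id.matrix_mulVec continuous_const
  have hs := h.hasSum.map (Matrix.mulVec.addMonoidHomLeft r) hcont
  simpa [valueVec, Function.comp_def, Matrix.mulVec.addMonoidHomLeft, Matrix.smul_mulVec]
    using hs.tsum_eq

/-- One-step value expansion. -/
theorem valueVec_eq_occupancy_step {S : Type*} [Fintype S] [DecidableEq S] {P : Matrix S S ℝ}
    (hP : P ∈ Matrix.rowStochastic ℝ S) {a b : ℝ} (ha0 : 0 ≤ a) (ha1 : a < 1)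
    (hb0 : 0 ≤ b) (hb1 : b < 1) (r : S → ℝ) :
    valueVec b P r = (1 / (1 - a)) • (occupancy a P).mulVec r +
      ((b - a) / (1 - a)) • (occupancy a P).mulVec (valueVec b P r) := by
  have ha := summable_discounted_pow hP ha0 ha1
  have hb := summable_discounted_pow hP hb0 hb1
  have hne : 1 - a ≠ 0 := (sub_pos.2 ha1).ne'
  rw [valueVec_eq_mulVec hb]
  simp only [occupancy, Matrix.smul_mulVec, smul_smul, Matrix.mulVec_mulVec, smul_mul_assoc]
  rw [one_div_mul_cancel hne, div_mul_cancel₀ _ hne, one_smul, ← Matrix.smul_mulVec,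
    ← Matrix.add_mulVec, ← tsum_smul_pow_succ_resolvent ha hb]

/-- Theorem 2 (γ-model-based value expansion), tabular form: the value vector decomposes
as a weighted average of `H` γ-model steps and a terminal value:
`V = (1/(1−γ̃)) ∑_{n=1}^H α_n (μ_γ^n r) + ((γ̃−γ)/(1−γ))^H (μ_γ^H V)`. -/
theorem gamma_mve {S : Type*} [Fintype S] [DecidableEq S] [Nonempty S]
    (P : Matrix S S ℝ) (hP0 : ∀ i j, 0 ≤ P i j) (hP1 : ∀ i, ∑ j, P i j = 1)
    (γ γt : ℝ) (h0 : 0 < γ) (h1 : γ < γt) (h2 : γt < 1)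
    (r : S → ℝ) (H : ℕ) (hH : 1 ≤ H) :
    valueVec γt P r =
      (1 / (1 - γt)) •
          (∑ n ∈ Finset.Icc 1 H, alpha γ γt n • (occupancy γ P ^ n).mulVec r) +
        ((γt - γ) / (1 - γ)) ^ H • (occupancy γ P ^ H).mulVec (valueVec γt P r) := by
  have hP : P ∈ Matrix.rowStochastic ℝ S := Matrix.mem_rowStochastic_iff_sum.2 ⟨hP0, hP1⟩
  have hstep := valueVec_eq_occupancy_step hP h0.le (h1.trans h2) (h0.trans h1).le h2 r
  have hne : 1 - γ ≠ 0 := (sub_pos.2 (h1.trans h2)).ne'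
  have hne' : 1 - γt ≠ 0 := (sub_pos.2 h2).ne'
  clear hH
  induction H with
  | zero => simp
  | succ H ih =>
    have hexp : ((γt - γ) / (1 - γ)) ^ H • (occupancy γ P ^ H).mulVec (valueVec γt P r) =
        (1 / (1 - γt)) • alpha γ γt (H + 1) • (occupancy γ P ^ (H + 1)).mulVec r +
          ((γt - γ) / (1 - γ)) ^ (H + 1) •
            (occupancy γ P ^ (H + 1)).mulVec (valueVec γt P r) := by
      have hcoef : 1 / (1 - γt) * alpha γ γt (H + 1) =
          ((γt - γ) / (1 - γ)) ^ H * (1 / (1 - γ)) := by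
        simp only [alpha, Nat.add_sub_cancel, div_pow]
        field_simp
        ring
      conv_lhs => rw [hstep]
      rw [smul_smul, hcoef, Matrix.mulVec_add, Matrix.mulVec_smul, Matrix.mulVec_smul,
        Matrix.mulVec_mulVec, Matrix.mulVec_mulVec, ← pow_succ, smul_add, smul_smul, smul_smul,
        ← pow_succ]
    rw [Finset.sum_Icc_succ_top (Nat.le_add_left 1 H), smul_add, add_assoc, ← hexp]
    exact ih
end

section
/- (Theorem 1, distribution form.) Let 0 ≤ γ < γ̃ < 1. Consider, for each n ≥ 1, the negative binomial probability mass function p_n on the positive integers given by p_n(t) = C(t−1, t−n) γ^{t−n} (1−γ)^n for t ≥ n and 0 otherwise, and the mixture weights α_n = (1−γ̃)(γ̃−γ)^{n−1}/(1−γ)^n. Then the α-mixture of the p_n equals the geometric distribution with parameter 1−γ̃: for every t ≥ 1, ∑_{n=1}^{∞} α_n p_n(t) = (1−γ̃) γ̃^{t−1}, and in particular the left-hand side defines a probability mass function on {1,2,3,...}. -/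
/-- The negative binomial pmf: `nbPMF γ n t = C(t−1, t−n) γ^(t−n) (1−γ)^n` for `t ≥ n`,
and `0` for `t < n`. -/
noncomputable def nbPMF (γ : ℝ) (n t : ℕ) : ℝ :=
  if n ≤ t then ((t - 1).choose (t - n) : ℝ) * γ ^ (t - n) * (1 - γ) ^ n else 0

/-- A single term of the mixture is a term of the binomial expansion of `((γt - γ) + γ) ^ s`,
scaled by `1 - γt`. -/
theorem alpha_mul_nbPMF {γ : ℝ} (γt : ℝ) (hγ : γ ≠ 1) {n s : ℕ} (hn : n ≤ s) :
    alpha γ γt (n + 1) * nbPMF γ (n + 1) (s + 1) =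
      (1 - γt) * ((γt - γ) ^ n * γ ^ (s - n) * (s.choose n : ℝ)) := by
  have hpow : (1 - γ) ^ (n + 1) ≠ 0 := pow_ne_zero _ (sub_ne_zero.mpr hγ.symm)
  simp only [alpha, nbPMF, add_le_add_iff_right, hn, if_true, Nat.add_sub_cancel,
    Nat.add_sub_add_right, Nat.choose_symm hn]
  field_simp

theorem tsum_alpha_mul_nbPMF {γ : ℝ} (γt : ℝ) (hγ : γ ≠ 1) (s : ℕ) :
    ∑' n : ℕ, alpha γ γt (n + 1) * nbPMF γ (n + 1) (s + 1) = (1 - γt) * γt ^ s := by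
  rw [tsum_eq_sum (s := Finset.range (s + 1))]
  · rw [Finset.sum_congr rfl fun n hn =>
        alpha_mul_nbPMF γt hγ (Nat.lt_succ_iff.mp (Finset.mem_range.mp hn)),
      ← Finset.mul_sum, ← add_pow, sub_add_cancel]
  · intro n hn
    have hlt : ¬ n + 1 ≤ s + 1 := by simpa using hn
    simp only [nbPMF, if_neg hlt, mul_zero]

/-- Theorem 1, distribution form: the `α`-mixture of the negative binomial pmfs
`p_n = NB(n, 1−γ)` equals the geometric distribution with parameter `1−γ̃`; in particular
the mixture defines a probability mass function on `{1, 2, 3, ...}`. -/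
theorem negBinomial_mixture_eq_geometric (γ γt : ℝ) (h0 : 0 ≤ γ) (h1 : γ < γt) (h2 : γt < 1) :
    (∀ t : ℕ, 1 ≤ t →
        ∑' n : ℕ, alpha γ γt (n + 1) * nbPMF γ (n + 1) t = (1 - γt) * γt ^ (t - 1)) ∧
      HasSum (fun t : ℕ => ∑' n : ℕ, alpha γ γt (n + 1) * nbPMF γ (n + 1) (t + 1)) 1 := by
  have hγ : γ ≠ 1 := (h1.trans h2).ne
  refine ⟨fun t ht => ?_, ?_⟩
  · obtain ⟨s, rfl⟩ := Nat.exists_eq_add_of_le' ht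
    exact tsum_alpha_mul_nbPMF γt hγ s
  · simp only [tsum_alpha_mul_nbPMF γt hγ]
    have hgeom := (hasSum_geometric_of_lt_one (h0.trans h1.le) h2).mul_left (1 - γt)
    rwa [mul_inv_cancel₀ (sub_pos.mpr h2).ne'] at hgeom
end

section
/- (Theorem 1, measure-theoretic form.) Let S be a measurable space, let κ be a Markov kernel from S to S, and let 0 < γ < γ̃ < 1. For each s ∈ S define the discounted occupancy measure μ_γ(s) = (1−γ) ∑_{t=1}^{∞} γ^{t−1} κ^t(s), and let μ_γ^{(n)} denote the n-fold kernel composition of the kernel s ↦ μ_γ(s) with itself. Then for every s ∈ S and measurable set A: μ_{γ̃}(s)(A) = ∑_{n=1}^{∞} α_n μ_γ^{(n)}(s)(A), where α_n = (1−γ̃)(γ̃−γ)^{n−1}/(1−γ)^n; i.e., reweighting the steps of a γ-model rollout by α_n recovers the occupancy with the larger discount γ̃. -/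
open MeasureTheory ProbabilityTheory

/-- `kpow κ t` is the `(t+1)`-fold composition `κ^(t+1)` of the kernel `κ` with itself. -/
noncomputable def kpow {S : Type*} [MeasurableSpace S] (κ : Kernel S S) : ℕ → Kernel S S
  | 0 => κ
  | t + 1 => κ ∘ₖ kpow κ t

/-- The discounted occupancy kernel `μ_γ = (1−γ) ∑_{t≥1} γ^(t−1) κ^t`. -/
noncomputable def occKernel {S : Type*} [MeasurableSpace S] (κ : Kernel S S) (γ : ℝ) :
    Kernel S S :=
  Kernel.sum fun t : ℕ =>
    { toFun := fun s => ENNReal.ofReal ((1 - γ) * γ ^ t) • kpow κ t s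
      measurable' := Measure.measurable_of_measurable_coe _ fun _A hA => by
        simp only [Measure.smul_apply, smul_eq_mul]
        exact (Kernel.measurable_coe _ hA).const_mul _ }

section AuxiliaryLemmas

variable {S : Type*} [MeasurableSpace S]

lemma kpow_comp_kpow (κ : Kernel S S) (i j : ℕ) :
    kpow κ i ∘ₖ kpow κ j = kpow κ (i + j + 1) := by
  induction i with
  | zero => rw [Nat.zero_add]; rfl
  | succ i ih =>
    rw [show i + 1 + j + 1 = (i + j + 1) + 1 by ring]
    simp only [kpow]
    rw [Kernel.comp_assoc, ih]
    rfl

lemma occKernel_apply (κ : Kernel S S) (γ : ℝ) (s : S) :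
    occKernel κ γ s =
      Measure.sum fun t : ℕ => ENNReal.ofReal ((1 - γ) * γ ^ t) • kpow κ t s := by
  rw [occKernel, Kernel.sum_apply]
  rfl

/-- The convolution of the geometric weights with the negative binomial weights. -/
lemma sum_antidiagonal_geometric_mul_choose (γ : ℝ) (n m : ℕ) :
    ∑ p ∈ Finset.HasAntidiagonal.antidiagonal m,
      ((1 - γ) * γ ^ p.1) * ((1 - γ) ^ (n + 1) * (p.2.choose n * γ ^ (p.2 - n))) =
    (1 - γ) ^ (n + 2) * ((m + 1).choose (n + 1) * γ ^ (m + 1 - (n + 1))) := by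
  have hterm : ∀ p ∈ Finset.HasAntidiagonal.antidiagonal m,
      ((1 - γ) * γ ^ p.1) * ((1 - γ) ^ (n + 1) * (p.2.choose n * γ ^ (p.2 - n))) =
        (1 - γ) ^ (n + 2) * γ ^ (m - n) * (p.2.choose n : ℝ) := by
    intro p hp
    rw [Finset.HasAntidiagonal.mem_antidiagonal] at hp
    rcases lt_or_ge p.2 n with h | h
    · simp [Nat.choose_eq_zero_of_lt h]
    · rw [show m - n = p.1 + (p.2 - n) by omega]
      ring
  rw [Finset.sum_congr rfl hterm, ← Finset.mul_sum,
    Finset.Nat.sum_antidiagonal_eq_sum_range_succ_mk,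
    ← Finset.sum_range_reflect]
  have hsum : ∑ j ∈ Finset.range (m + 1), j.choose n = (m + 1).choose (n + 1) := by
    generalize m + 1 = k
    induction k with
    | zero => simp
    | succ k ih => rw [Finset.sum_range_succ, ih, Nat.choose_succ_succ, add_comm]
  rw [Nat.add_sub_add_right, ← hsum]
  push_cast
  rw [Finset.sum_congr rfl (g := fun j => (j.choose n : ℝ))]
  · ring
  · intro j hj
    rw [Finset.mem_range] at hj
    congr 2
    omega

/-- The number of `κ`-steps taken by `n + 1` steps of the `γ`-occupancy kernel is negative
binomially distributed. -/
lemma kpow_occKernel_apply (κ : Kernel S S) {γ : ℝ} (h0 : 0 ≤ γ) (h1 : γ ≤ 1) (n : ℕ) (s : S) :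
    kpow (occKernel κ γ) n s = Measure.sum fun t : ℕ =>
      ENNReal.ofReal ((1 - γ) ^ (n + 1) * (t.choose n * γ ^ (t - n))) • kpow κ t s := by
  have h1' : 0 ≤ 1 - γ := sub_nonneg.2 h1
  induction n with
  | zero => simpa [kpow] using occKernel_apply κ γ s
  | succ n ih =>
    ext A hA
    set a : ℕ → ℝ := fun i => (1 - γ) * γ ^ i
    set b : ℕ → ℝ := fun j => (1 - γ) ^ (n + 1) * (j.choose n * γ ^ (j - n))
    have ha0 : ∀ i, 0 ≤ a i := fun i => by positivity
    have hb0 : ∀ i, 0 ≤ b i := fun i => by positivity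
    have hocc : ∀ x, occKernel κ γ x A = ∑' i, ENNReal.ofReal (a i) * kpow κ i x A := by
      intro x
      rw [occKernel_apply, Measure.sum_apply _ hA]
      rfl
    have hlint : ∀ j, ∫⁻ x, occKernel κ γ x A ∂(kpow κ j s) =
        ∑' i, ENNReal.ofReal (a i) * kpow κ (i + j + 1) s A := by
      intro j
      simp_rw [hocc]
      rw [lintegral_tsum fun i => ((Kernel.measurable_coe _ hA).const_mul _).aemeasurable]
      refine tsum_congr fun i => ?_
      rw [lintegral_const_mul _ (Kernel.measurable_coe _ hA), ← kpow_comp_kpow,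
        Kernel.comp_apply' _ _ _ hA]
    calc kpow (occKernel κ γ) (n + 1) s A
        = ∑' j, ∑' i, ENNReal.ofReal (a i * b j) * kpow κ (i + j + 1) s A := by
          rw [kpow, Kernel.comp_apply' _ _ _ hA, ih, lintegral_sum_measure]
          refine tsum_congr fun j => ?_
          rw [lintegral_smul_measure, hlint, smul_eq_mul, ← ENNReal.tsum_mul_left]
          refine tsum_congr fun i => ?_
          rw [ENNReal.ofReal_mul (ha0 i)]
          ring
      _ = ∑' m, ∑ p ∈ Finset.HasAntidiagonal.antidiagonal m,
            ENNReal.ofReal (a p.1 * b p.2) * kpow κ (m + 1) s A := by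
          rw [ENNReal.tsum_comm, ← ENNReal.tsum_prod,
            ← Finset.HasAntidiagonal.sigmaAntidiagonalEquivProd.tsum_eq, ENNReal.tsum_sigma']
          refine tsum_congr fun m => ?_
          rw [tsum_fintype, ← Finset.sum_coe_sort (Finset.HasAntidiagonal.antidiagonal m)]
          refine Finset.sum_congr rfl fun p _ => ?_
          have hp := Finset.HasAntidiagonal.mem_antidiagonal.1 p.2
          simp [Finset.HasAntidiagonal.sigmaAntidiagonalEquivProd, hp]
      _ = _ := by
          symm
          rw [Measure.sum_apply _ hA, tsum_eq_zero_add' ENNReal.summable]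
          simp only [Measure.smul_apply, smul_eq_mul, Nat.choose_zero_succ, Nat.cast_zero,
            zero_mul, mul_zero, ENNReal.ofReal_zero, zero_add]
          refine tsum_congr fun m => ?_
          rw [← Finset.sum_mul, ← ENNReal.ofReal_sum_of_nonneg
            fun p _ => mul_nonneg (ha0 _) (hb0 _), sum_antidiagonal_geometric_mul_choose]

/-- The weights `alpha` mix the negative binomial weights into a geometric weight. -/
lemma sum_alpha_mul_choose {γ γt : ℝ} (h : γ ≠ 1) (t : ℕ) :
    ∑ n ∈ Finset.range (t + 1),
      alpha γ γt (n + 1) * ((1 - γ) ^ (n + 1) * (t.choose n * γ ^ (t - n))) =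
    (1 - γt) * γt ^ t := by
  have h' : 1 - γ ≠ 0 := sub_ne_zero.2 h.symm
  conv_rhs => rw [← sub_add_cancel γt γ, add_pow, Finset.mul_sum]
  refine Finset.sum_congr rfl fun n _ => ?_
  rw [alpha, Nat.add_sub_cancel]
  field_simp
  ring

end AuxiliaryLemmas

/-- Theorem 1, measure-theoretic form: reweighting the steps of a `γ`-model rollout by the
weights `α n` recovers the discounted occupancy with the larger discount `γ̃`:
`μ_γ̃(s)(A) = ∑_{n≥1} α_n μ_γ^{(n)}(s)(A)`, where `μ_γ^{(n)}` is the `n`-fold kernel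
composition of the occupancy kernel `μ_γ` with itself. -/
theorem occupancy_kernel_reweighting {S : Type*} [MeasurableSpace S]
    (κ : Kernel S S) [IsMarkovKernel κ]
    (γ γt : ℝ) (h0 : 0 < γ) (h1 : γ < γt) (h2 : γt < 1)
    (s : S) (A : Set S) (hA : MeasurableSet A) :
    occKernel κ γt s A =
      ∑' n : ℕ, ENNReal.ofReal (alpha γ γt (n + 1)) * kpow (occKernel κ γ) n s A := by
  have hα : ∀ n, 0 ≤ alpha γ γt (n + 1) := fun n =>
    div_nonneg (mul_nonneg (by linarith) (pow_nonneg (by linarith) _))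
      (pow_nonneg (by linarith) _)
  have hγ : 0 ≤ 1 - γ := by linarith
  have hterm : ∀ n, ENNReal.ofReal (alpha γ γt (n + 1)) * kpow (occKernel κ γ) n s A =
      ∑' t : ℕ, ENNReal.ofReal (alpha γ γt (n + 1) *
        ((1 - γ) ^ (n + 1) * (t.choose n * γ ^ (t - n)))) * kpow κ t s A := by
    intro n
    rw [kpow_occKernel_apply κ h0.le (by linarith), Measure.sum_apply _ hA,
      ← ENNReal.tsum_mul_left]
    refine tsum_congr fun t => ?_
    rw [ENNReal.ofReal_mul (hα n), Measure.smul_apply, smul_eq_mul, mul_assoc]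
  rw [tsum_congr hterm, ENNReal.tsum_comm, occKernel_apply, Measure.sum_apply _ hA]
  refine tsum_congr fun t => ?_
  rw [ENNReal.tsum_mul_right, Measure.smul_apply, smul_eq_mul,
    ← sum_alpha_mul_choose (γ := γ) (by linarith) t,
    ENNReal.ofReal_sum_of_nonneg fun n _ => mul_nonneg (hα n) (by positivity),
    tsum_eq_sum fun n hn => ?_]
  rw [Finset.mem_range, not_lt] at hn
  simp [Nat.choose_eq_zero_of_lt (show t < n by omega)]
end
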